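/- For $a\in(0,1/2]$ and $r\in(0,1)$ let $\mathcal{K}_a(r)=\frac{\pi}{2}F(a,1-a;1;r^2)$, where $F(a,b;c;x)=\sum_{n\ge 0}\frac{(a)_n(b)_n}{(c)_n\,n!}x^n$ is the Gaussian hypergeometric function, and let $\mu_a(r)=\frac{\pi}{2\sin(\pi a)}\,\frac{\mathcal{K}_a(\sqrt{1-r^2})}{\mathcal{K}_a(r)}$, a strictly decreasing homeomorphism from $(0,1)$ onto $(0,\infty)$. For $K>0$ let $\varphi_K^a(r)=\mu_a^{-1}(\mu_a(r)/K)$ and $\lambda_a(K)=\left(\varphi_K^a(1/\sqrt2)/\varphi_{1/K}^a(1/\sqrt2)\right)^2$. Let $a\in(0,1/2]$ and $t=4\,\mathcal{K}_a(1/\sqrt2)^2/(\pi\sin(\pi a))$. Then: (1) the function $K\mapsto \log(\lambda_a(K))/(K-1)$ is strictly decreasing from $(1,\infty)$ onto $(\pi/\sin(\pi a),\,t)$; (2) the function $K\mapsto (\lambda_a(K)-1)/(K-1)$ is strictly increasing from $(1,\infty)$ onto $(t,\infty)$. In particular, for every $K>1$, $$\max\{e^{\pi(K-1)/\sin(\pi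 a)},\;1+t(K-1)\}<\lambda_a(K)<e^{t(K-1)}.$$ -/

import Mathlib

/-- The generalized complete elliptic integral of the first kind,
`𝒦ₐ(r) = (π/2) F(a, 1-a; 1; r²)`, with Mathlib's Gaussian hypergeometric function. -/
noncomputable def ellK (a r : ℝ) : ℝ :=
  Real.pi / 2 * ordinaryHypergeometric a (1 - a) (1 : ℝ) (r ^ 2)

/-- `μₐ(r) = (π / (2 sin(πa))) · 𝒦ₐ(r') / 𝒦ₐ(r)` with `r' = √(1 - r²)`. -/
noncomputable def muFn (a r : ℝ) : ℝ :=
  Real.pi / (2 * Real.sin (Real.pi * a)) * (ellK a (Real.sqrt (1 - r ^ 2)) / ellK a r)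

/-- The inverse of `μₐ : (0,1) → (0,∞)`. -/
noncomputable def muInv (a : ℝ) : ℝ → ℝ := Function.invFunOn (muFn a) (Set.Ioo 0 1)

/-- The modular function `φ_K^a(r) = μₐ⁻¹(μₐ(r) / K)`. -/
noncomputable def phiK (a K r : ℝ) : ℝ := muInv a (muFn a r / K)

/-- `λₐ(K) = (φ_K^a(1/√2) / φ_{1/K}^a(1/√2))²`. -/
noncomputable def lambdaA (a K : ℝ) : ℝ :=
  (phiK a K (1 / Real.sqrt 2) / phiK a (1 / K) (1 / Real.sqrt 2)) ^ 2

open Filter Topology Set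

/-! ### Power series with bounded coefficients -/

theorem summable_natCast_mul_pow_of_bounded {b : ℕ → ℝ} (hb : ∀ n, |b n| ≤ 1) {x : ℝ}
    (hx : |x| < 1) : Summable fun n : ℕ => (n : ℝ) * b n * x ^ n := by
  have h := (summable_norm_pow_mul_geometric_of_norm_lt_one 1 (r := x) (by simpa using hx))
  refine Summable.of_norm_bounded h fun n => ?_
  simp only [Real.norm_eq_abs, abs_mul, pow_one]
  have := mul_le_mul_of_nonneg_left (hb n) (mul_nonneg (abs_nonneg (n : ℝ)) (abs_nonneg (x ^ n)))
  linarith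

theorem summable_mul_pow_of_bounded {b : ℕ → ℝ} (hb : ∀ n, |b n| ≤ 1) {x : ℝ}
    (hx : |x| < 1) : Summable fun n : ℕ => b n * x ^ n := by
  have h := (summable_norm_pow_mul_geometric_of_norm_lt_one 0 (r := x) (by simpa using hx))
  refine Summable.of_norm_bounded h fun n => ?_
  simp only [Real.norm_eq_abs, abs_mul, pow_zero, one_mul]
  exact mul_le_of_le_one_left (abs_nonneg _) (hb n)

theorem hasDerivAt_tsum_mul_pow_of_bounded {b : ℕ → ℝ} (hb : ∀ n, |b n| ≤ 1) {x : ℝ}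
    (hx : |x| < 1) :
    HasDerivAt (fun y => ∑' n, b n * y ^ n) (∑' n : ℕ, ((n : ℝ) + 1) * b (n + 1) * x ^ n) x := by
  obtain ⟨ρ, hxρ, hρ⟩ := exists_between hx
  have hρ0 : 0 < ρ := (abs_nonneg x).trans_lt hxρ
  have hu : Summable fun n : ℕ => (n : ℝ) * ρ ^ (n - 1) := by
    rw [← summable_nat_add_iff 1]
    have h1 := summable_natCast_mul_pow_of_bounded (b := fun _ => 1) (by simp)
      (x := ρ) (by rwa [abs_of_pos hρ0])
    have h2 := summable_mul_pow_of_bounded (b := fun _ => 1) (by simp)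
      (x := ρ) (by rwa [abs_of_pos hρ0])
    refine (h1.add h2).congr fun n => ?_
    push_cast
    ring
  have key := hasDerivAt_tsum_of_isPreconnected (g := fun n y => b n * y ^ n)
    (g' := fun n y => b n * ((n : ℝ) * y ^ (n - 1))) (t := Ioo (-ρ) ρ) (y₀ := 0) (y := x)
    hu isOpen_Ioo isPreconnected_Ioo
    (fun n y _ => (hasDerivAt_pow n y).const_mul (b n)) ?_ ⟨by linarith, hρ0⟩
    (summable_mul_pow_of_bounded hb (by simp)) (abs_lt.1 hxρ)
  · refine key.congr_deriv ?_
    have hs : Summable fun n : ℕ => b n * ((n : ℝ) * x ^ (n - 1)) := by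
      refine Summable.of_norm_bounded hu fun n => ?_
      rw [Real.norm_eq_abs, abs_mul, abs_mul, abs_pow, Nat.abs_cast]
      refine (mul_le_of_le_one_left (by positivity) (hb n)).trans ?_
      gcongr
    rw [hs.tsum_eq_zero_add]
    simp only [Nat.cast_zero, zero_mul, mul_zero, zero_add, Nat.add_sub_cancel]
    refine tsum_congr fun n => ?_
    push_cast
    ring
  · intro n y hy
    rw [Real.norm_eq_abs, abs_mul, abs_mul, abs_pow, Nat.abs_cast]
    refine (mul_le_of_le_one_left (by positivity) (hb n)).trans ?_
    have : |y| ≤ ρ := abs_le.2 ⟨hy.1.le, hy.2.le⟩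
    gcongr

/-! ### The zero-balanced hypergeometric function `F(a, 1-a; 1; x)` -/

/-- The Taylor coefficients of `F(a, 1-a; 1; x)`. -/
noncomputable def hypCoeff (a : ℝ) (n : ℕ) : ℝ :=
  ∏ j ∈ Finset.range n, ((a + j) * (1 - a + j) / ((j : ℝ) + 1) ^ 2)

/-- The function `F(a, 1-a; 1; x)` as a power series. -/
noncomputable def hypF (a x : ℝ) : ℝ := ∑' n, hypCoeff a n * x ^ n

/-- The power series of `(1 - x) F'(x)`, where `F(x) = F(a, 1-a; 1; x)`. -/
noncomputable def hypQ (a x : ℝ) : ℝ := ∑' n : ℕ, a * (1 - a) * hypCoeff a n / (n + 1) * x ^ n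

theorem hypCoeff_zero (a : ℝ) : hypCoeff a 0 = 1 := by simp [hypCoeff]

theorem hypCoeff_succ (a : ℝ) (n : ℕ) :
    hypCoeff a (n + 1) = hypCoeff a n * ((a + n) * (1 - a + n) / ((n : ℝ) + 1) ^ 2) := by
  rw [hypCoeff, Finset.prod_range_succ, ← hypCoeff]

theorem hypCoeff_eq (a : ℝ) (n : ℕ) : hypCoeff a n =
    ((n.factorial : ℝ)⁻¹ * (ascPochhammer ℝ n).eval a * (ascPochhammer ℝ n).eval (1 - a) *
      ((ascPochhammer ℝ n).eval 1)⁻¹) := by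
  induction n with
  | zero => simp [hypCoeff]
  | succ n ih =>
    rw [hypCoeff_succ, ih, ascPochhammer_succ_eval, ascPochhammer_succ_eval, ascPochhammer_eval_one,
      ascPochhammer_eval_one, Nat.factorial_succ]
    have : (n.factorial : ℝ) ≠ 0 := by positivity
    have : (n : ℝ) + 1 ≠ 0 := by positivity
    push_cast
    field_simp

theorem ordinaryHypergeometric_eq_hypF (a x : ℝ) :
    ordinaryHypergeometric a (1 - a) (1 : ℝ) x = hypF a x := by
  rw [ordinaryHypergeometric_eq_tsum]
  exact tsum_congr fun n => by rw [hypCoeff_eq, smul_eq_mul]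

variable {a : ℝ}

theorem hypCoeff_pos (ha0 : 0 < a) (ha1 : a < 1) (n : ℕ) : 0 < hypCoeff a n := by
  refine Finset.prod_pos fun j _ => ?_
  have : 0 < 1 - a := by linarith
  positivity

theorem hypCoeff_le_one (ha0 : 0 < a) (ha1 : a < 1) (n : ℕ) : hypCoeff a n ≤ 1 := by
  refine Finset.prod_le_one (fun j _ => ?_) (fun j _ => ?_)
  · have : 0 < 1 - a := by linarith
    positivity
  · rw [div_le_one (by positivity)]
    have : (0 : ℝ) ≤ j := by positivity
    nlinarith

theorem abs_hypCoeff_le (ha0 : 0 < a) (ha1 : a < 1) (n : ℕ) : |hypCoeff a n| ≤ 1 := by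
  rw [abs_of_pos (hypCoeff_pos ha0 ha1 n)]
  exact hypCoeff_le_one ha0 ha1 n

theorem succ_mul_hypCoeff_succ (a : ℝ) (n : ℕ) :
    ((n : ℝ) + 1) * hypCoeff a (n + 1) - n * hypCoeff a n =
      a * (1 - a) * hypCoeff a n / (n + 1) := by
  rw [hypCoeff_succ]
  have : (n : ℝ) + 1 ≠ 0 := by positivity
  field_simp
  ring

theorem mul_one_sub_le_quarter (a : ℝ) : a * (1 - a) ≤ 1 / 4 := by
  nlinarith [sq_nonneg (a - 1 / 2)]

theorem hypQ_coeff_pos (ha0 : 0 < a) (ha1 : a < 1) (n : ℕ) :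
    0 < a * (1 - a) * hypCoeff a n / (n + 1) := by
  have := hypCoeff_pos ha0 ha1 n
  have : 0 < 1 - a := by linarith
  positivity

theorem hypQ_coeff_le (ha0 : 0 < a) (ha1 : a < 1) (n : ℕ) :
    a * (1 - a) * hypCoeff a n / (n + 1) ≤ 1 / 4 * hypCoeff a n := by
  have h := hypCoeff_pos ha0 ha1 n
  rw [div_le_iff₀ (by positivity)]
  have h1 := mul_le_mul_of_nonneg_right (mul_one_sub_le_quarter a) h.le
  have h2 : 0 ≤ hypCoeff a n * n := by positivity
  linarith

theorem abs_hypQ_coeff_le (ha0 : 0 < a) (ha1 : a < 1) (n : ℕ) :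
    |a * (1 - a) * hypCoeff a n / (n + 1)| ≤ 1 := by
  rw [abs_of_pos (hypQ_coeff_pos ha0 ha1 n)]
  linarith [hypQ_coeff_le ha0 ha1 n, hypCoeff_le_one ha0 ha1 n]

theorem hypF_zero (a : ℝ) : hypF a 0 = 1 := by
  rw [hypF, tsum_eq_single 0 (fun n hn => by simp [hn])]
  simp [hypCoeff_zero]

theorem hypF_pos (ha0 : 0 < a) (ha1 : a < 1) {x : ℝ} (hx0 : 0 ≤ x) (hx1 : x < 1) :
    0 < hypF a x := by
  refine (summable_mul_pow_of_bounded (abs_hypCoeff_le ha0 ha1)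
    (by rwa [abs_of_nonneg hx0])).tsum_pos
    (fun n => mul_nonneg (hypCoeff_pos ha0 ha1 n).le (by positivity)) 0 ?_
  simp [hypCoeff_zero]

theorem hypQ_pos (ha0 : 0 < a) (ha1 : a < 1) {x : ℝ} (hx0 : 0 ≤ x) (hx1 : x < 1) :
    0 < hypQ a x := by
  refine (summable_mul_pow_of_bounded (abs_hypQ_coeff_le ha0 ha1)
    (by rwa [abs_of_nonneg hx0])).tsum_pos
    (fun n => mul_nonneg (hypQ_coeff_pos ha0 ha1 n).le (by positivity)) 0 ?_
  simpa using hypQ_coeff_pos ha0 ha1 0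

theorem hypQ_le (ha0 : 0 < a) (ha1 : a < 1) {x : ℝ} (hx0 : 0 ≤ x) (hx1 : x < 1) :
    hypQ a x ≤ 1 / 4 * hypF a x := by
  have hx : |x| < 1 := by rwa [abs_of_nonneg hx0]
  rw [hypQ, hypF, ← tsum_mul_left]
  refine Summable.tsum_le_tsum (fun n => ?_)
    (summable_mul_pow_of_bounded (abs_hypQ_coeff_le ha0 ha1) hx)
    ((summable_mul_pow_of_bounded (abs_hypCoeff_le ha0 ha1) hx).mul_left _)
  rw [← mul_assoc]
  exact mul_le_mul_of_nonneg_right (hypQ_coeff_le ha0 ha1 n) (by positivity)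

theorem hasDerivAt_hypF (ha0 : 0 < a) (ha1 : a < 1) {x : ℝ} (hx : |x| < 1) :
    HasDerivAt (hypF a) (hypQ a x / (1 - x)) x := by
  refine (hasDerivAt_tsum_mul_pow_of_bounded (abs_hypCoeff_le ha0 ha1) hx).congr_deriv ?_
  have h1x : 1 - x ≠ 0 := by linarith [(abs_lt.1 hx).2]
  have h1 := summable_natCast_mul_pow_of_bounded (abs_hypCoeff_le ha0 ha1) hx
  have h2 := summable_mul_pow_of_bounded (abs_hypQ_coeff_le ha0 ha1) hx
  have h3 : Summable fun n : ℕ => ((n : ℝ) + 1) * hypCoeff a (n + 1) * x ^ n := by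
    refine (h1.add h2).congr fun n => ?_
    rw [← succ_mul_hypCoeff_succ]
    ring
  have h4 : ∑' n : ℕ, (n : ℝ) * hypCoeff a n * x ^ n =
      x * ∑' n : ℕ, ((n : ℝ) + 1) * hypCoeff a (n + 1) * x ^ n := by
    rw [h1.tsum_eq_zero_add, ← tsum_mul_left]
    simp only [Nat.cast_zero, zero_mul, zero_add]
    refine tsum_congr fun n => ?_
    push_cast
    ring
  rw [eq_div_iff h1x, mul_sub, mul_one, mul_comm _ x, ← h4, ← h3.tsum_sub h1, hypQ]
  refine tsum_congr fun n => ?_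
  rw [← succ_mul_hypCoeff_succ]
  ring

theorem hasDerivAt_id_mul_hypQ (ha0 : 0 < a) (ha1 : a < 1) {x : ℝ} (hx : |x| < 1) :
    HasDerivAt (fun y => y * hypQ a y) (a * (1 - a) * hypF a x) x := by
  set b : ℕ → ℝ := fun n => Nat.casesOn n 0 fun n => a * (1 - a) * hypCoeff a n / (n + 1) with hb
  have hb1 : ∀ n, |b n| ≤ 1 := by
    rintro (_ | n)
    · simp [hb]
    · exact abs_hypQ_coeff_le ha0 ha1 n
  have key := hasDerivAt_tsum_mul_pow_of_bounded hb1 hx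
  have e1 : ∑' n : ℕ, ((n : ℝ) + 1) * b (n + 1) * x ^ n = a * (1 - a) * hypF a x := by
    rw [hypF, ← tsum_mul_left]
    refine tsum_congr fun n => ?_
    have : (n : ℝ) + 1 ≠ 0 := by positivity
    simp only [hb]
    field_simp
  rw [e1] at key
  refine key.congr_of_eventuallyEq ?_
  have : ∀ᶠ y in 𝓝 x, |y| < 1 := continuous_abs.continuousAt.eventually_lt continuousAt_const hx
  filter_upwards [this] with y hy
  rw [(summable_mul_pow_of_bounded hb1 hy).tsum_eq_zero_add, hypQ, ← tsum_mul_left]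
  rw [show b 0 * y ^ 0 = 0 by simp [hb], zero_add]
  exact tsum_congr fun n => by simp only [hb]; ring

theorem tendsto_mul_hypCoeff (ha0 : 0 < a) (ha1 : a < 1) :
    Tendsto (fun n : ℕ => (n : ℝ) * hypCoeff a n) atTop (𝓝 (Real.sin (Real.pi * a) / Real.pi)) := by
  have hG := (Real.GammaSeq_tendsto_Gamma a).mul (Real.GammaSeq_tendsto_Gamma (1 - a))
  rw [Real.Gamma_mul_Gamma_one_sub] at hG
  have hsin : 0 < Real.sin (Real.pi * a) :=
    Real.sin_pos_of_pos_of_lt_pi (by positivity) (by nlinarith [Real.pi_pos])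
  have hG' := hG.inv₀ (by positivity)
  rw [inv_div] at hG'
  rw [← tendsto_add_atTop_iff_nat 1]
  have h1 : Tendsto (fun n : ℕ => (n : ℝ) / (n + 1)) atTop (𝓝 1) :=
    tendsto_natCast_div_add_atTop 1
  have h2 := hG'.mul h1
  rw [mul_one] at h2
  refine h2.congr' ?_
  filter_upwards [eventually_gt_atTop 0] with n hn
  have hn' : (0 : ℝ) < n := by exact_mod_cast hn
  have hc : hypCoeff a (n + 1) = (∏ j ∈ Finset.range (n + 1), (a + j)) *
      (∏ j ∈ Finset.range (n + 1), (1 - a + j)) / (((n + 1).factorial : ℝ)) ^ 2 := by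
    rw [hypCoeff, Finset.prod_div_distrib, Finset.prod_mul_distrib, Finset.prod_pow,
      ← Finset.prod_range_add_one_eq_factorial]
    push_cast
    rfl
  rw [hc, Real.GammaSeq, Real.GammaSeq, Nat.factorial_succ]
  have p1 : (n : ℝ) ^ a * (n : ℝ) ^ (1 - a) = n := by
    rw [← Real.rpow_add hn']
    simp
  have q1 : ∏ j ∈ Finset.range (n + 1), (a + j) ≠ 0 :=
    (Finset.prod_pos fun j _ => by positivity).ne'
  have q2 : ∏ j ∈ Finset.range (n + 1), (1 - a + j) ≠ 0 :=
    (Finset.prod_pos fun j _ => by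
      have : 0 < 1 - a := by linarith
      positivity).ne'
  have q3 : (n.factorial : ℝ) ≠ 0 := by positivity
  have q4 : (n : ℝ) + 1 ≠ 0 := by positivity
  generalize (∏ j ∈ Finset.range (n + 1), (a + (j : ℝ))) = A at *
  generalize (∏ j ∈ Finset.range (n + 1), (1 - a + (j : ℝ))) = B at *
  rw [div_mul_div_comm, mul_mul_mul_comm, p1]
  push_cast
  field_simp

theorem tendsto_hypQ_one (ha0 : 0 < a) (ha1 : a < 1) :
    Tendsto (hypQ a) (𝓝[<] 1) (𝓝 (Real.sin (Real.pi * a) / Real.pi)) := by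
  refine Real.tendsto_tsum_powerSeries_nhdsWithin_lt
    ((tendsto_mul_hypCoeff ha0 ha1).congr fun n => ?_)
  simp_rw [← succ_mul_hypCoeff_succ]
  have := Finset.sum_range_sub (fun k : ℕ => (k : ℝ) * hypCoeff a k) n
  push_cast at this
  rw [this]
  simp

/-! ### Monotone forms of l'Hôpital's rule -/

theorem strictMonoOn_div_of_strictMonoOn_deriv_div {f g f' g' : ℝ → ℝ} {p q : ℝ}
    (hf : ∀ x ∈ Ico p q, HasDerivAt f (f' x) x) (hg : ∀ x ∈ Ico p q, HasDerivAt g (g' x) x)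
    (hfp : f p = 0) (hgp : g p = 0) (hg' : ∀ x ∈ Ioo p q, 0 < g' x)
    (hmono : StrictMonoOn (fun x => f' x / g' x) (Ioo p q)) :
    StrictMonoOn (fun x => f x / g x) (Ioo p q) := by
  have hcf : ContinuousOn f (Ico p q) := fun x hx => (hf x hx).continuousAt.continuousWithinAt
  have hcg : ContinuousOn g (Ico p q) := fun x hx => (hg x hx).continuousAt.continuousWithinAt
  have hgm : StrictMonoOn g (Ico p q) := by
    refine strictMonoOn_of_deriv_pos (convex_Ico p q) hcg fun x hx => ?_
    rw [interior_Ico] at hx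
    rw [(hg x (Ioo_subset_Ico_self hx)).deriv]
    exact hg' x hx
  have cauchy : ∀ x y, p ≤ x → x < y → y < q →
      ∃ ξ ∈ Ioo x y, (g y - g x) * f' ξ = (f y - f x) * g' ξ := fun x y hx hxy hy =>
    exists_ratio_hasDerivAt_eq_ratio_slope f f' hxy
      (hcf.mono fun z hz => ⟨hx.trans hz.1, hz.2.trans_lt hy⟩)
      (fun z hz => hf z ⟨hx.trans hz.1.le, hz.2.trans hy⟩) g g'
      (hcg.mono fun z hz => ⟨hx.trans hz.1, hz.2.trans_lt hy⟩)
      (fun z hz => hg z ⟨hx.trans hz.1.le, hz.2.trans hy⟩)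
  intro x hx y hy hxy
  obtain ⟨ξ, hξ, e₁⟩ := cauchy p x le_rfl hx.1 hx.2
  obtain ⟨η, hη, e₂⟩ := cauchy x y hx.1.le hxy hy.2
  have hξ' : ξ ∈ Ioo p q := ⟨hξ.1, hξ.2.trans hx.2⟩
  have hη' : η ∈ Ioo p q := ⟨hx.1.trans hη.1, hη.2.trans hy.2⟩
  have hlt := hmono hξ' hη' (hξ.2.trans hη.1)
  have gx : 0 < g x := hgp ▸ hgm ⟨le_rfl, hx.1.trans hx.2⟩ ⟨hx.1.le, hx.2⟩ hx.1
  have gxy : g x < g y := hgm ⟨hx.1.le, hx.2⟩ ⟨hy.1.le, hy.2⟩ hxy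
  rw [hfp, hgp, sub_zero, sub_zero] at e₁
  have r₁ : f' ξ / g' ξ = f x / g x := by
    rw [div_eq_div_iff (hg' ξ hξ').ne' gx.ne']
    linarith
  have r₂ : f' η / g' η = (f y - f x) / (g y - g x) := by
    rw [div_eq_div_iff (hg' η hη').ne' (by linarith)]
    linarith
  simp only [r₁, r₂] at hlt
  show f x / g x < f y / g y
  rw [div_lt_div_iff₀ gx (by linarith)] at hlt ⊢
  linarith

theorem tendsto_div_of_hasDerivAt_zero {f g : ℝ → ℝ} {f' g' p : ℝ} (hf : HasDerivAt f f' p)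
    (hg : HasDerivAt g g' p) (hfp : f p = 0) (hgp : g p = 0) (hg' : g' ≠ 0) :
    Tendsto (fun x => f x / g x) (𝓝[>] p) (𝓝 (f' / g')) := by
  have h := ((hasDerivAt_iff_tendsto_slope.1 hf).div
    (hasDerivAt_iff_tendsto_slope.1 hg) hg').mono_left (nhdsWithin_mono p fun x (hx : p < x) => ne_of_gt hx)
  refine h.congr' ?_
  filter_upwards [self_mem_nhdsWithin] with x hx
  have : x - p ≠ 0 := sub_ne_zero.2 (ne_of_gt hx)
  simp only [Pi.div_apply, slope_def_field, hfp, hgp, sub_zero]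
  field_simp

theorem tendsto_div_of_tendsto_deriv_div_atTop {f g f' g' : ℝ → ℝ} {p q l : ℝ} (hpq : p < q)
    (hf : ∀ x ∈ Ioo p q, HasDerivAt f (f' x) x) (hg : ∀ x ∈ Ioo p q, HasDerivAt g (g' x) x)
    (hg' : ∀ x ∈ Ioo p q, 0 < g' x) (hgtop : Tendsto g (𝓝[<] q) atTop)
    (hl : Tendsto (fun x => f' x / g' x) (𝓝[<] q) (𝓝 l)) :
    Tendsto (fun x => f x / g x) (𝓝[<] q) (𝓝 l) := by
  rw [Metric.tendsto_nhds] at hl ⊢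
  intro ε hε
  have h₁ := (hl (ε / 2) (by positivity)).and (Ioo_mem_nhdsLT hpq)
  obtain ⟨c, hc, hcs⟩ := (mem_nhdsLT_iff_exists_Ioo_subset' hpq).1 h₁
  obtain ⟨x₀, hx₀⟩ := exists_between (show c < q from hc)
  have hx₀' := hcs hx₀
  set M := |f x₀ - l * g x₀| + ε / 2 * |g x₀| with hM
  filter_upwards [Ioo_mem_nhdsLT hx₀.2, hgtop.eventually_gt_atTop (max 0 (2 * M / ε))] with x hx hgx
  have gx : 0 < g x := (le_max_left _ _).trans_lt hgx
  have gM : M < ε / 2 * g x := by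
    have := (le_max_right _ _).trans_lt hgx
    rw [div_lt_iff₀ hε] at this
    linarith
  have hsub : Icc x₀ x ⊆ Ioo p q := fun z hz =>
    ⟨hx₀'.2.1.trans_le hz.1, hz.2.trans_lt hx.2⟩
  obtain ⟨ξ, hξ, e⟩ := exists_ratio_hasDerivAt_eq_ratio_slope f f' hx.1
    (fun z hz => (hf z (hsub hz)).continuousAt.continuousWithinAt)
    (fun z hz => hf z (hsub (Ioo_subset_Icc_self hz))) g g'
    (fun z hz => (hg z (hsub hz)).continuousAt.continuousWithinAt)
    (fun z hz => hg z (hsub (Ioo_subset_Icc_self hz)))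
  have gξ := hg' ξ (hsub (Ioo_subset_Icc_self hξ))
  have hd : dist (f' ξ / g' ξ) l < ε / 2 := (hcs ⟨hx₀.1.trans hξ.1, hξ.2.trans hx.2⟩).1
  rw [Real.dist_eq] at hd ⊢
  have e' : f x - l * g x = (f' ξ / g' ξ - l) * (g x - g x₀) + (f x₀ - l * g x₀) := by
    have : f x - f x₀ = f' ξ / g' ξ * (g x - g x₀) := by
      field_simp
      linarith
    linarith
  have hb : |f x - l * g x| < ε * g x := by
    rw [e']
    calc |(f' ξ / g' ξ - l) * (g x - g x₀) + (f x₀ - l * g x₀)|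
        ≤ |f' ξ / g' ξ - l| * |g x - g x₀| + |f x₀ - l * g x₀| := by
          rw [← abs_mul]; exact abs_add_le _ _
      _ ≤ ε / 2 * (g x + |g x₀|) + |f x₀ - l * g x₀| := by
          have : |g x - g x₀| ≤ g x + |g x₀| := (abs_sub _ _).trans (by rw [abs_of_pos gx])
          gcongr
      _ = ε / 2 * g x + M := by rw [hM]; ring
      _ < ε * g x := by linarith
  have : f x / g x - l = (f x - l * g x) / g x := by field_simp
  rwa [this, abs_div, abs_of_pos gx, div_lt_iff₀ gx]

/-! ### Images of intervals under strictly monotone functions -/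

theorem StrictMonoOn.lt_of_tendsto_nhdsGT {f : ℝ → ℝ} {p q l x : ℝ}
    (hf : StrictMonoOn f (Ioo p q)) (hl : Tendsto f (𝓝[>] p) (𝓝 l)) (hx : x ∈ Ioo p q) :
    l < f x := by
  obtain ⟨y, hy⟩ := exists_between hx.1
  have hy' : y ∈ Ioo p q := ⟨hy.1, hy.2.trans hx.2⟩
  refine lt_of_le_of_lt ?_ (hf hy' hx hy.2)
  refine le_of_tendsto hl ?_
  filter_upwards [Ioo_mem_nhdsGT hy.1] with z hz
  exact (hf ⟨hz.1, hz.2.trans hy'.2⟩ hy' hz.2).le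

theorem StrictMonoOn.lt_of_tendsto_nhdsLT {f : ℝ → ℝ} {p q l x : ℝ}
    (hf : StrictMonoOn f (Ioo p q)) (hl : Tendsto f (𝓝[<] q) (𝓝 l)) (hx : x ∈ Ioo p q) :
    f x < l := by
  obtain ⟨y, hy⟩ := exists_between hx.2
  have hy' : y ∈ Ioo p q := ⟨hx.1.trans hy.1, hy.2⟩
  refine lt_of_lt_of_le (hf hx hy' hy.1) ?_
  refine ge_of_tendsto hl ?_
  filter_upwards [Ioo_mem_nhdsLT hy.2] with z hz
  exact (hf hy' ⟨hy'.1.trans hz.1, hz.2⟩ hz.1).le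

theorem StrictMonoOn.image_Ioo_eq_Ioo {f : ℝ → ℝ} {p q l m : ℝ} (hpq : p < q)
    (hf : StrictMonoOn f (Ioo p q)) (hc : ContinuousOn f (Ioo p q))
    (hl : Tendsto f (𝓝[>] p) (𝓝 l)) (hm : Tendsto f (𝓝[<] q) (𝓝 m)) :
    f '' Ioo p q = Ioo l m := by
  apply Subset.antisymm
  · rintro _ ⟨x, hx, rfl⟩
    exact ⟨hf.lt_of_tendsto_nhdsGT hl hx, hf.lt_of_tendsto_nhdsLT hm hx⟩
  · exact isPreconnected_Ioo.intermediate_value_Ioo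
      (le_principal_iff.2 (Ioo_mem_nhdsGT hpq)) (le_principal_iff.2 (Ioo_mem_nhdsLT hpq)) hc hl hm

theorem StrictMonoOn.image_Ioo_eq_Ioi {f : ℝ → ℝ} {p q l : ℝ} (hpq : p < q)
    (hf : StrictMonoOn f (Ioo p q)) (hc : ContinuousOn f (Ioo p q))
    (hl : Tendsto f (𝓝[>] p) (𝓝 l)) (hm : Tendsto f (𝓝[<] q) atTop) :
    f '' Ioo p q = Ioi l := by
  apply Subset.antisymm
  · rintro _ ⟨x, hx, rfl⟩
    exact hf.lt_of_tendsto_nhdsGT hl hx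
  · exact isPreconnected_Ioo.intermediate_value_Ioi
      (le_principal_iff.2 (Ioo_mem_nhdsGT hpq)) (le_principal_iff.2 (Ioo_mem_nhdsLT hpq)) hc hl hm

/-! ### The Legendre relation and the ratio `F(x) / F(1 - x)` -/

theorem sin_pi_mul_div_pi_pos (ha0 : 0 < a) (ha1 : a < 1) :
    0 < Real.sin (Real.pi * a) / Real.pi :=
  div_pos (Real.sin_pos_of_pos_of_lt_pi (by positivity) (by nlinarith [Real.pi_pos])) Real.pi_pos

theorem continuousOn_hypF (ha0 : 0 < a) (ha1 : a < 1) : ContinuousOn (hypF a) (Ico 0 1) :=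
  fun x hx => (hasDerivAt_hypF ha0 ha1
    (by rw [abs_of_nonneg hx.1]; exact hx.2)).continuousAt.continuousWithinAt

theorem strictMonoOn_hypF (ha0 : 0 < a) (ha1 : a < 1) : StrictMonoOn (hypF a) (Ico 0 1) := by
  refine strictMonoOn_of_deriv_pos (convex_Ico 0 1) (continuousOn_hypF ha0 ha1) fun x hx => ?_
  rw [interior_Ico] at hx
  rw [(hasDerivAt_hypF ha0 ha1 (by rw [abs_of_pos hx.1]; exact hx.2)).deriv]
  exact div_pos (hypQ_pos ha0 ha1 hx.1.le hx.2) (by linarith [hx.2])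

theorem antitoneOn_one_sub_mul_hypF_sq (ha0 : 0 < a) (ha1 : a < 1) :
    AntitoneOn (fun x => (1 - x) * hypF a x ^ 2) (Ico 0 1) := by
  have hd : ∀ x ∈ Ico (0 : ℝ) 1, HasDerivAt (fun x => (1 - x) * hypF a x ^ 2)
      (hypF a x * (2 * hypQ a x - hypF a x)) x := by
    intro x hx
    have h := hasDerivAt_hypF ha0 ha1 (x := x) (by rw [abs_of_nonneg hx.1]; exact hx.2)
    have h1 : 1 - x ≠ 0 := by linarith [hx.2]
    refine (((hasDerivAt_id x).const_sub 1).mul (h.pow 2)).congr_deriv ?_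
    simp only [id, Pi.pow_apply]
    field_simp
    push_cast
    ring
  refine antitoneOn_of_deriv_nonpos (convex_Ico 0 1)
    (fun x hx => (hd x hx).continuousAt.continuousWithinAt) ?_ ?_
  · rw [interior_Ico]
    exact fun x hx => (hd x (Ioo_subset_Ico_self hx)).differentiableAt.differentiableWithinAt
  · rw [interior_Ico]
    intro x hx
    rw [(hd x (Ioo_subset_Ico_self hx)).deriv]
    have h1 := hypF_pos ha0 ha1 hx.1.le hx.2
    have h2 := hypQ_le ha0 ha1 hx.1.le hx.2
    exact mul_nonpos_of_nonneg_of_nonpos h1.le (by linarith)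

theorem tendsto_one_sub_nhdsLT_one : Tendsto (fun x : ℝ => 1 - x) (𝓝[<] 1) (𝓝 0) := by
  have : Tendsto (fun x : ℝ => 1 - x) (𝓝 1) (𝓝 (1 - 1)) :=
    (continuous_const.sub continuous_id).tendsto 1
  rw [sub_self] at this
  exact this.mono_left nhdsWithin_le_nhds

theorem tendsto_one_sub_mul_hypF (ha0 : 0 < a) (ha1 : a < 1) :
    Tendsto (fun x => (1 - x) * hypF a x) (𝓝[<] 1) (𝓝 0) := by
  have hs : Tendsto (fun x : ℝ => √(1 - x)) (𝓝[<] 1) (𝓝 0) := by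
    have := (Real.continuous_sqrt.tendsto 0).comp tendsto_one_sub_nhdsLT_one
    rwa [Real.sqrt_zero] at this
  refine squeeze_zero' ?_ ?_ hs
  · filter_upwards [Ioo_mem_nhdsLT zero_lt_one] with x hx
    exact mul_nonneg (by linarith [hx.2]) (hypF_pos ha0 ha1 hx.1.le hx.2).le
  · filter_upwards [Ioo_mem_nhdsLT zero_lt_one] with x hx
    have h := antitoneOn_one_sub_mul_hypF_sq ha0 ha1 (left_mem_Ico.2 zero_lt_one)
      (Ioo_subset_Ico_self hx) hx.1.le
    simp only [hypF_zero, sub_zero, one_pow, mul_one] at h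
    apply Real.le_sqrt_of_sq_le
    have := mul_le_mul_of_nonneg_left h (show 0 ≤ 1 - x by linarith [hx.2])
    linarith

theorem tendsto_hypF_one_sub (ha0 : 0 < a) (ha1 : a < 1) :
    Tendsto (fun x => hypF a (1 - x)) (𝓝[<] 1) (𝓝 1) := by
  have := (hasDerivAt_hypF ha0 ha1 (x := 0) (by simp)).continuousAt.tendsto
  rw [hypF_zero] at this
  exact this.comp tendsto_one_sub_nhdsLT_one

theorem hypF_legendre (ha0 : 0 < a) (ha1 : a < 1) {x : ℝ} (hx : x ∈ Ioo (0 : ℝ) 1) :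
    x * hypQ a x * hypF a (1 - x) + hypF a x * ((1 - x) * hypQ a (1 - x)) =
      Real.sin (Real.pi * a) / Real.pi := by
  set W : ℝ → ℝ := fun x =>
    x * hypQ a x * hypF a (1 - x) + hypF a x * ((1 - x) * hypQ a (1 - x)) with hW
  have hd : ∀ x ∈ Ioo (0 : ℝ) 1, HasDerivAt W 0 x := by
    intro x hx
    have hx1 : |x| < 1 := by rw [abs_of_pos hx.1]; exact hx.2
    have hx2 : |1 - x| < 1 := by rw [abs_of_pos] <;> linarith [hx.1, hx.2]
    have hs : HasDerivAt (fun x : ℝ => 1 - x) (-1) x := (hasDerivAt_id x).const_sub 1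
    have d1 := hasDerivAt_hypF ha0 ha1 hx1
    have d2 := (hasDerivAt_hypF ha0 ha1 hx2).comp x hs
    have d3 := hasDerivAt_id_mul_hypQ ha0 ha1 hx1
    have d4 := (hasDerivAt_id_mul_hypQ ha0 ha1 hx2).comp x hs
    refine ((d3.mul d2).add (d1.mul d4)).congr_deriv ?_
    have h1 : 1 - x ≠ 0 := by linarith [hx.2]
    have h2 : x ≠ 0 := hx.1.ne'
    simp only [Function.comp_apply, sub_sub_cancel]
    field_simp
    ring
  have hconst : ∀ y ∈ Ioo (0 : ℝ) 1, W y = W x := fun y hy =>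
    isOpen_Ioo.is_const_of_deriv_eq_zero isPreconnected_Ioo
      (fun z hz => (hd z hz).differentiableAt.differentiableWithinAt)
      (fun z hz => (hd z hz).deriv) hy hx
  have hlim : Tendsto W (𝓝[<] 1) (𝓝 (Real.sin (Real.pi * a) / Real.pi)) := by
    have t1 : Tendsto (fun x : ℝ => x) (𝓝[<] 1) (𝓝 1) := nhdsWithin_le_nhds
    have hq : Tendsto (fun x => x * hypQ a x * hypF a (1 - x)) (𝓝[<] 1)
        (𝓝 (1 * (Real.sin (Real.pi * a) / Real.pi) * 1)) :=
      (t1.mul (tendsto_hypQ_one ha0 ha1)).mul (tendsto_hypF_one_sub ha0 ha1)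
    have hz : Tendsto (fun x => hypF a x * ((1 - x) * hypQ a (1 - x))) (𝓝[<] 1) (𝓝 0) := by
      have hb : ∀ᶠ x in 𝓝[<] (1 : ℝ), hypQ a (1 - x) ≤ hypF a (1 - x) := by
        filter_upwards [Ioo_mem_nhdsLT zero_lt_one] with x hx
        have h1 := hypQ_le ha0 ha1 (x := 1 - x) (by linarith [hx.2]) (by linarith [hx.1])
        have h2 := hypF_pos ha0 ha1 (x := 1 - x) (by linarith [hx.2]) (by linarith [hx.1])
        linarith
      have h0 := (tendsto_one_sub_mul_hypF ha0 ha1).mul (tendsto_hypF_one_sub ha0 ha1)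
      rw [zero_mul] at h0
      refine squeeze_zero' ?_ ?_ h0
      · filter_upwards [Ioo_mem_nhdsLT zero_lt_one] with x hx
        have h1 := hypQ_pos ha0 ha1 (x := 1 - x) (by linarith [hx.2]) (by linarith [hx.1])
        have h2 := hypF_pos ha0 ha1 hx.1.le hx.2
        have h3 : 0 < 1 - x := by linarith [hx.2]
        positivity
      · filter_upwards [hb, Ioo_mem_nhdsLT zero_lt_one] with x hx hx'
        have h2 := hypF_pos ha0 ha1 hx'.1.le hx'.2
        have h3 : 0 < 1 - x := by linarith [hx'.2]
        have := mul_le_mul_of_nonneg_left hx (mul_pos h3 h2).le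
        linarith
    simpa using hq.add hz
  refine tendsto_nhds_unique (tendsto_const_nhds.congr' ?_) hlim
  filter_upwards [Ioo_mem_nhdsLT zero_lt_one] with y hy
  exact (hconst y hy).symm

/-- The ratio `F(x) / F(1 - x)` for `F(x) = F(a, 1-a; 1; x)`. -/
noncomputable def hypRatio (a x : ℝ) : ℝ := hypF a x / hypF a (1 - x)

theorem hasDerivAt_hypRatio (ha0 : 0 < a) (ha1 : a < 1) {x : ℝ} (hx : x ∈ Ioo (0 : ℝ) 1) :
    HasDerivAt (hypRatio a)
      (Real.sin (Real.pi * a) / Real.pi / (x * (1 - x) * hypF a (1 - x) ^ 2)) x := by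
  have hx1 : |x| < 1 := by rw [abs_of_pos hx.1]; exact hx.2
  have hx2 : |1 - x| < 1 := by rw [abs_of_pos] <;> linarith [hx.1, hx.2]
  have hs : HasDerivAt (fun x : ℝ => 1 - x) (-1) x := (hasDerivAt_id x).const_sub 1
  have d1 := hasDerivAt_hypF ha0 ha1 hx1
  have d2 := (hasDerivAt_hypF ha0 ha1 hx2).comp x hs
  have hp := (hypF_pos ha0 ha1 (x := 1 - x) (by linarith [hx.2]) (by linarith [hx.1])).ne'
  refine (d1.div d2 hp).congr_deriv ?_
  rw [← hypF_legendre ha0 ha1 hx]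
  have h1 : 1 - x ≠ 0 := by linarith [hx.2]
  have h2 : x ≠ 0 := hx.1.ne'
  simp only [Function.comp_apply, sub_sub_cancel]
  field_simp
  ring

theorem deriv_hypRatio_pos (ha0 : 0 < a) (ha1 : a < 1) {x : ℝ} (hx : x ∈ Ioo (0 : ℝ) 1) :
    0 < Real.sin (Real.pi * a) / Real.pi / (x * (1 - x) * hypF a (1 - x) ^ 2) := by
  have h1 := sin_pi_mul_div_pi_pos ha0 ha1
  have h2 := hypF_pos ha0 ha1 (x := 1 - x) (by linarith [hx.2]) (by linarith [hx.1])
  have h3 := hx.1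
  have h4 : 0 < 1 - x := by linarith [hx.2]
  positivity

theorem strictMonoOn_hypRatio (ha0 : 0 < a) (ha1 : a < 1) :
    StrictMonoOn (hypRatio a) (Ioo 0 1) := by
  refine strictMonoOn_of_deriv_pos (convex_Ioo 0 1)
    (fun x hx => (hasDerivAt_hypRatio ha0 ha1 hx).continuousAt.continuousWithinAt) fun x hx => ?_
  rw [interior_Ioo] at hx
  rw [(hasDerivAt_hypRatio ha0 ha1 hx).deriv]
  exact deriv_hypRatio_pos ha0 ha1 hx

theorem hypRatio_half (ha0 : 0 < a) (ha1 : a < 1) : hypRatio a (1 / 2) = 1 := by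
  rw [hypRatio, show (1 : ℝ) - 1 / 2 = 1 / 2 by norm_num]
  exact div_self (hypF_pos ha0 ha1 (by norm_num) (by norm_num)).ne'

theorem hypRatio_one_sub (a x : ℝ) : hypRatio a (1 - x) = (hypRatio a x)⁻¹ := by
  rw [hypRatio, hypRatio, sub_sub_cancel, inv_div]

/-! ### The modular functions in terms of `F(x) / F(1 - x)` -/

theorem ellK_eq (a r : ℝ) : ellK a r = Real.pi / 2 * hypF a (r ^ 2) := by
  rw [ellK, ordinaryHypergeometric_eq_hypF]

theorem muFn_eq (a : ℝ) {r : ℝ} (hr : r ^ 2 ≤ 1) :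
    muFn a r = Real.pi / (2 * Real.sin (Real.pi * a)) * hypRatio a (1 - r ^ 2) := by
  rw [muFn, ellK_eq, ellK_eq, Real.sq_sqrt (by linarith), hypRatio, sub_sub_cancel,
    mul_div_mul_left _ _ (by positivity)]

theorem half_pi_div_sin_pos (ha0 : 0 < a) (ha1 : a < 1) :
    0 < Real.pi / (2 * Real.sin (Real.pi * a)) := by
  have : 0 < Real.sin (Real.pi * a) :=
    Real.sin_pos_of_pos_of_lt_pi (by positivity) (by nlinarith [Real.pi_pos])
  positivity

theorem injOn_muFn (ha0 : 0 < a) (ha1 : a < 1) : InjOn (muFn a) (Ioo 0 1) := by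
  intro r hr s hs h
  have sq_mem : ∀ r ∈ Ioo (0 : ℝ) 1, 1 - r ^ 2 ∈ Ioo (0 : ℝ) 1 := fun r hr =>
    ⟨by nlinarith [hr.1, hr.2], by nlinarith [hr.1, hr.2]⟩
  rw [muFn_eq a (by linarith [(sq_mem r hr).1]), muFn_eq a (by linarith [(sq_mem s hs).1])] at h
  have h' := mul_left_cancel₀ (half_pi_div_sin_pos ha0 ha1).ne' h
  have h'' := (strictMonoOn_hypRatio ha0 ha1).injOn (sq_mem r hr) (sq_mem s hs) h'
  exact (pow_left_inj₀ hr.1.le hs.1.le two_ne_zero).1 (by linarith)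

theorem muInv_eq (ha0 : 0 < a) (ha1 : a < 1) {x : ℝ} (hx : x ∈ Ioo (0 : ℝ) 1) :
    muInv a (Real.pi / (2 * Real.sin (Real.pi * a)) * hypRatio a (1 - x)) = √x := by
  have hm : √x ∈ Ioo (0 : ℝ) 1 := ⟨Real.sqrt_pos.2 hx.1, by
    rw [Real.sqrt_lt' one_pos]; simpa using hx.2⟩
  have e : muFn a (√x) = Real.pi / (2 * Real.sin (Real.pi * a)) * hypRatio a (1 - x) := by
    rw [muFn_eq a (by rw [Real.sq_sqrt hx.1.le]; exact hx.2.le), Real.sq_sqrt hx.1.le]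
  rw [← e]
  exact (injOn_muFn ha0 ha1).leftInvOn_invFunOn hm

theorem one_div_sqrt_two_sq : (1 / √2 : ℝ) ^ 2 = 1 / 2 := by
  rw [div_pow, Real.sq_sqrt zero_le_two, one_pow]

theorem muFn_one_div_sqrt_two (ha0 : 0 < a) (ha1 : a < 1) :
    muFn a (1 / √2) = Real.pi / (2 * Real.sin (Real.pi * a)) := by
  rw [muFn_eq a (by rw [one_div_sqrt_two_sq]; norm_num), one_div_sqrt_two_sq,
    show (1 : ℝ) - 1 / 2 = 1 / 2 by norm_num, hypRatio_half ha0 ha1, mul_one]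

theorem lambdaA_hypRatio (ha0 : 0 < a) (ha1 : a < 1) {x : ℝ} (hx : x ∈ Ioo (0 : ℝ) 1) :
    lambdaA a (hypRatio a x) = x / (1 - x) := by
  have hx' : 1 - x ∈ Ioo (0 : ℝ) 1 := ⟨by linarith [hx.2], by linarith [hx.1]⟩
  have e₁ : phiK a (hypRatio a x) (1 / √2) = √x := by
    rw [phiK, muFn_one_div_sqrt_two ha0 ha1, div_eq_mul_inv _ (hypRatio a x), ← hypRatio_one_sub,
      muInv_eq ha0 ha1 hx]
  have e₂ : phiK a (1 / hypRatio a x) (1 / √2) = √(1 - x) := by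
    rw [phiK, muFn_one_div_sqrt_two ha0 ha1, div_div_eq_mul_div, div_one, ← muInv_eq ha0 ha1 hx',
      sub_sub_cancel]
  rw [lambdaA, e₁, e₂, div_pow, Real.sq_sqrt hx.1.le, Real.sq_sqrt hx'.1.le]

/-! ### Quotients over `(1/2, 1)` -/

theorem hasDerivAt_div_one_sub {x : ℝ} (hx : x < 1) :
    HasDerivAt (fun x : ℝ => x / (1 - x)) (1 / (1 - x) ^ 2) x := by
  have h1 : 1 - x ≠ 0 := by linarith
  refine ((hasDerivAt_id x).div ((hasDerivAt_id x).const_sub 1) h1).congr_deriv ?_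
  simp only [id]
  congr 1
  ring

theorem hasDerivAt_log_div_one_sub {x : ℝ} (hx : x ∈ Ioo (0 : ℝ) 1) :
    HasDerivAt (fun x : ℝ => Real.log (x / (1 - x))) (1 / (x * (1 - x))) x := by
  have h1 : 1 - x ≠ 0 := by linarith [hx.2]
  have h2 := hx.1.ne'
  refine ((hasDerivAt_div_one_sub hx.2).log (div_ne_zero h2 h1)).congr_deriv ?_
  field_simp

theorem tendsto_div_one_sub_atTop : Tendsto (fun x : ℝ => x / (1 - x)) (𝓝[<] 1) atTop := by
  have h0 : Tendsto (fun x : ℝ => 1 - x) (𝓝[<] 1) (𝓝[>] 0) :=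
    tendsto_nhdsWithin_iff.2 ⟨tendsto_one_sub_nhdsLT_one, by
      filter_upwards [self_mem_nhdsWithin] with x hx
      exact sub_pos.2 (mem_Iio.1 hx)⟩
  have t1 : Tendsto (fun x : ℝ => x) (𝓝[<] 1) (𝓝 1) := nhdsWithin_le_nhds
  exact t1.pos_mul_atTop one_pos h0.inv_tendsto_nhdsGT_zero

theorem tendsto_log_div_one_sub_atTop :
    Tendsto (fun x : ℝ => Real.log (x / (1 - x))) (𝓝[<] 1) atTop :=
  Real.tendsto_log_atTop.comp tendsto_div_one_sub_atTop

theorem Ico_half_subset : Ico (1 / 2 : ℝ) 1 ⊆ Ioo 0 1 :=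
  fun _ hx => ⟨by linarith [hx.1], hx.2⟩

theorem one_lt_hypRatio (ha0 : 0 < a) (ha1 : a < 1) {x : ℝ} (hx : x ∈ Ioo (1 / 2 : ℝ) 1) :
    1 < hypRatio a x := by
  rw [← hypRatio_half ha0 ha1]
  exact strictMonoOn_hypRatio ha0 ha1 (by norm_num) (Ico_half_subset ⟨hx.1.le, hx.2⟩) hx.1

theorem hasDerivAt_hypRatio_half (ha0 : 0 < a) (ha1 : a < 1) :
    HasDerivAt (fun x => hypRatio a x - 1)
      (4 / (Real.pi / Real.sin (Real.pi * a) * hypF a (1 / 2) ^ 2)) (1 / 2) := by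
  refine ((hasDerivAt_hypRatio ha0 ha1 (x := 1 / 2) (by norm_num)).sub_const 1).congr_deriv ?_
  rw [show (1 : ℝ) - 1 / 2 = 1 / 2 by norm_num]
  field_simp
  norm_num

theorem hypRatio_scale_pos (ha0 : 0 < a) (ha1 : a < 1) :
    0 < Real.pi / Real.sin (Real.pi * a) * hypF a (1 / 2) ^ 2 := by
  have h1 := sin_pi_mul_div_pi_pos ha0 ha1
  have h2 := hypF_pos ha0 ha1 (x := 1 / 2) (by norm_num) (by norm_num)
  rw [← inv_div]
  positivity

theorem tendsto_quotient_half (ha0 : 0 < a) (ha1 : a < 1) {f : ℝ → ℝ} {f' : ℝ}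
    (hf : HasDerivAt f (4 * f') (1 / 2)) (hf0 : f (1 / 2) = 0) :
    Tendsto (fun x => f x / (hypRatio a x - 1)) (𝓝[>] (1 / 2))
      (𝓝 (f' * (Real.pi / Real.sin (Real.pi * a) * hypF a (1 / 2) ^ 2))) := by
  have hp := hypRatio_scale_pos ha0 ha1
  have := tendsto_div_of_hasDerivAt_zero hf (hasDerivAt_hypRatio_half ha0 ha1) hf0
    (by simp only [hypRatio_half ha0 ha1, sub_self]) (by positivity)
  convert this using 2
  field_simp

theorem strictMonoOn_quotient (ha0 : 0 < a) (ha1 : a < 1) {f f' : ℝ → ℝ}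
    (hf : ∀ x ∈ Ico (1 / 2 : ℝ) 1, HasDerivAt f (f' x) x) (hf0 : f (1 / 2) = 0)
    (hmono : StrictMonoOn (fun x => f' x * (x * (1 - x) * hypF a (1 - x) ^ 2)) (Ioo (1 / 2) 1)) :
    StrictMonoOn (fun x => f x / (hypRatio a x - 1)) (Ioo (1 / 2) 1) := by
  refine strictMonoOn_div_of_strictMonoOn_deriv_div hf
    (fun x hx => (hasDerivAt_hypRatio ha0 ha1 (Ico_half_subset hx)).sub_const 1) hf0
    (by rw [hypRatio_half ha0 ha1, sub_self])
    (fun x hx => deriv_hypRatio_pos ha0 ha1 (Ico_half_subset ⟨hx.1.le, hx.2⟩)) ?_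
  intro x hx y hy hxy
  have := div_lt_div_of_pos_right (hmono hx hy hxy) (sin_pi_mul_div_pi_pos ha0 ha1)
  simpa only [div_div_eq_mul_div] using this

theorem continuousOn_quotient (ha0 : 0 < a) (ha1 : a < 1) {f f' : ℝ → ℝ}
    (hf : ∀ x ∈ Ico (1 / 2 : ℝ) 1, HasDerivAt f (f' x) x) :
    ContinuousOn (fun x => f x / (hypRatio a x - 1)) (Ioo (1 / 2) 1) := by
  intro x hx
  have hx' : x ∈ Ico (1 / 2 : ℝ) 1 := Ioo_subset_Ico_self hx
  exact ((hf x hx').continuousAt.div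
    ((hasDerivAt_hypRatio ha0 ha1 (Ico_half_subset hx')).sub_const 1).continuousAt
    (by linarith [one_lt_hypRatio ha0 ha1 hx])).continuousWithinAt

theorem hypF_one_sub_lt (ha0 : 0 < a) (ha1 : a < 1) {x y : ℝ} (hx : x ∈ Ioo (0 : ℝ) 1)
    (hy : y ∈ Ioo (0 : ℝ) 1) (hxy : x < y) : hypF a (1 - y) < hypF a (1 - x) :=
  strictMonoOn_hypF ha0 ha1 ⟨by linarith [hy.2], by linarith [hy.1]⟩
    ⟨by linarith [hx.2], by linarith [hx.1]⟩ (by linarith)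

theorem hasDerivAt_neg_log_div_one_sub {x : ℝ} (hx : x ∈ Ico (1 / 2 : ℝ) 1) :
    HasDerivAt (fun x : ℝ => -Real.log (x / (1 - x))) (-(1 / (x * (1 - x)))) x :=
  (hasDerivAt_log_div_one_sub (Ico_half_subset hx)).neg

theorem neg_log_div_one_sub_half : -Real.log ((1 / 2 : ℝ) / (1 - 1 / 2)) = 0 := by norm_num

theorem strictMonoOn_neg_log_quotient (ha0 : 0 < a) (ha1 : a < 1) :
    StrictMonoOn (fun x => -Real.log (x / (1 - x)) / (hypRatio a x - 1)) (Ioo (1 / 2) 1) := by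
  refine strictMonoOn_quotient ha0 ha1 (fun x hx => hasDerivAt_neg_log_div_one_sub hx)
    neg_log_div_one_sub_half ?_
  have e : EqOn (fun x => -hypF a (1 - x) ^ 2)
      (fun x => -(1 / (x * (1 - x))) * (x * (1 - x) * hypF a (1 - x) ^ 2)) (Ioo (1 / 2) 1) := by
    intro x hx
    have h1 : 1 - x ≠ 0 := by linarith [hx.2]
    have h2 : x ≠ 0 := by linarith [hx.1]
    simp only
    field_simp
  refine StrictMonoOn.congr ?_ e
  intro x hx y hy hxy
  have hx' := Ico_half_subset (Ioo_subset_Ico_self hx)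
  have hy' := Ico_half_subset (Ioo_subset_Ico_self hy)
  have hp := hypF_pos ha0 ha1 (x := 1 - y) (by linarith [hy.2]) (by linarith [hy'.1])
  exact neg_lt_neg (pow_lt_pow_left₀ (hypF_one_sub_lt ha0 ha1 hx' hy' hxy) hp.le two_ne_zero)

theorem tendsto_neg_log_quotient_half (ha0 : 0 < a) (ha1 : a < 1) :
    Tendsto (fun x => -Real.log (x / (1 - x)) / (hypRatio a x - 1)) (𝓝[>] (1 / 2))
      (𝓝 (-(Real.pi / Real.sin (Real.pi * a) * hypF a (1 / 2) ^ 2))) := by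
  have := tendsto_quotient_half ha0 ha1 (f' := -1)
    ((hasDerivAt_neg_log_div_one_sub (x := 1 / 2) (by norm_num)).congr_deriv (by norm_num))
    neg_log_div_one_sub_half
  rwa [neg_one_mul] at this

theorem tendsto_hypRatio_atTop (ha0 : 0 < a) (ha1 : a < 1) :
    Tendsto (fun x => hypRatio a x - 1) (𝓝[<] 1) atTop := by
  have hp := hypRatio_scale_pos ha0 ha1
  refine tendsto_atTop_mono' _ ?_ (tendsto_log_div_one_sub_atTop.atTop_div_const hp)
  filter_upwards [Ioo_mem_nhdsLT (show (1 / 2 : ℝ) < 1 by norm_num)] with x hx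
  have h := (strictMonoOn_neg_log_quotient ha0 ha1).lt_of_tendsto_nhdsGT
    (tendsto_neg_log_quotient_half ha0 ha1) hx
  have hr := one_lt_hypRatio ha0 ha1 hx
  rw [lt_div_iff₀ (by linarith)] at h
  rw [div_le_iff₀ hp]
  linarith

theorem tendsto_neg_log_quotient_one (ha0 : 0 < a) (ha1 : a < 1) :
    Tendsto (fun x => -Real.log (x / (1 - x)) / (hypRatio a x - 1)) (𝓝[<] 1)
      (𝓝 (-(Real.pi / Real.sin (Real.pi * a)))) := by
  have hs : Ioo (1 / 2 : ℝ) 1 ⊆ Ioo 0 1 := Ioo_subset_Ico_self.trans Ico_half_subset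
  refine tendsto_div_of_tendsto_deriv_div_atTop (show (1 / 2 : ℝ) < 1 by norm_num)
    (fun x hx => hasDerivAt_neg_log_div_one_sub (Ioo_subset_Ico_self hx))
    (fun x hx => (hasDerivAt_hypRatio ha0 ha1 (hs hx)).sub_const 1)
    (fun x hx => deriv_hypRatio_pos ha0 ha1 (hs hx)) (tendsto_hypRatio_atTop ha0 ha1) ?_
  have h := (((tendsto_hypF_one_sub ha0 ha1).pow 2).mul_const
    (-(Real.pi / Real.sin (Real.pi * a))))
  rw [one_pow, one_mul] at h
  refine h.congr' ?_
  filter_upwards [Ioo_mem_nhdsLT (zero_lt_one (α := ℝ))] with x hx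
  have h1 : 1 - x ≠ 0 := by linarith [hx.2]
  have h2 : x ≠ 0 := hx.1.ne'
  field_simp

theorem image_neg_log_quotient (ha0 : 0 < a) (ha1 : a < 1) :
    (fun x => -Real.log (x / (1 - x)) / (hypRatio a x - 1)) '' Ioo (1 / 2) 1 =
      Ioo (-(Real.pi / Real.sin (Real.pi * a) * hypF a (1 / 2) ^ 2))
        (-(Real.pi / Real.sin (Real.pi * a))) :=
  (strictMonoOn_neg_log_quotient ha0 ha1).image_Ioo_eq_Ioo (by norm_num)
    (continuousOn_quotient ha0 ha1 fun _ hx => hasDerivAt_neg_log_div_one_sub hx)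
    (tendsto_neg_log_quotient_half ha0 ha1) (tendsto_neg_log_quotient_one ha0 ha1)

theorem hasDerivAt_div_one_sub_sub_one {x : ℝ} (hx : x ∈ Ico (1 / 2 : ℝ) 1) :
    HasDerivAt (fun x : ℝ => x / (1 - x) - 1) (1 / (1 - x) ^ 2) x :=
  (hasDerivAt_div_one_sub hx.2).sub_const 1

theorem div_one_sub_sub_one_half : (1 / 2 : ℝ) / (1 - 1 / 2) - 1 = 0 := by norm_num

theorem strictMonoOn_odds_quotient (ha0 : 0 < a) (ha1 : a < 1) :
    StrictMonoOn (fun x => (x / (1 - x) - 1) / (hypRatio a x - 1)) (Ioo (1 / 2) 1) := by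
  refine strictMonoOn_quotient ha0 ha1 (fun x hx => hasDerivAt_div_one_sub_sub_one hx)
    div_one_sub_sub_one_half ?_
  have e : EqOn (fun x => (1 - (1 - x)) * hypF a (1 - x) ^ 2 / (1 - x))
      (fun x => 1 / (1 - x) ^ 2 * (x * (1 - x) * hypF a (1 - x) ^ 2)) (Ioo (1 / 2) 1) := by
    intro x hx
    have h1 : 1 - x ≠ 0 := by linarith [hx.2]
    simp only [sub_sub_cancel]
    field_simp
  refine StrictMonoOn.congr ?_ e
  intro x hx y hy hxy
  have h := antitoneOn_one_sub_mul_hypF_sq ha0 ha1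
    (show 1 - y ∈ Ico (0 : ℝ) 1 from ⟨by linarith [hy.2], by linarith [hy.1]⟩)
    (show 1 - x ∈ Ico (0 : ℝ) 1 from ⟨by linarith [hx.2], by linarith [hx.1]⟩) (by linarith)
  have hp := hypF_pos ha0 ha1 (x := 1 - y) (by linarith [hy.2]) (by linarith [hy.1])
  exact div_lt_div₀' h (by linarith) (mul_pos (by linarith [hy.1]) (by positivity))
    (by linarith [hy.2])

theorem tendsto_odds_quotient_half (ha0 : 0 < a) (ha1 : a < 1) :
    Tendsto (fun x => (x / (1 - x) - 1) / (hypRatio a x - 1)) (𝓝[>] (1 / 2))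
      (𝓝 (Real.pi / Real.sin (Real.pi * a) * hypF a (1 / 2) ^ 2)) := by
  have := tendsto_quotient_half ha0 ha1 (f' := 1)
    ((hasDerivAt_div_one_sub_sub_one (x := 1 / 2) (by norm_num)).congr_deriv (by norm_num))
    div_one_sub_sub_one_half
  rwa [one_mul] at this

theorem tendsto_odds_quotient_one (ha0 : 0 < a) (ha1 : a < 1) :
    Tendsto (fun x => (x / (1 - x) - 1) / (hypRatio a x - 1)) (𝓝[<] 1) atTop := by
  have hS : 0 < Real.pi / Real.sin (Real.pi * a) := by
    rw [← inv_div]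
    exact inv_pos.2 (sin_pi_mul_div_pi_pos ha0 ha1)
  refine tendsto_atTop_mono' _ ?_
    (tendsto_log_div_one_sub_atTop.const_mul_atTop (half_pos hS))
  filter_upwards [Ioo_mem_nhdsLT (show (1 / 2 : ℝ) < 1 by norm_num)] with x hx
  have h := (strictMonoOn_neg_log_quotient ha0 ha1).lt_of_tendsto_nhdsLT
    (tendsto_neg_log_quotient_one ha0 ha1) hx
  have hr := one_lt_hypRatio ha0 ha1 hx
  have h1 : 0 < 1 - x := by linarith [hx.2]
  have hx1 : 1 ≤ x / (1 - x) := by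
    rw [le_div_iff₀ h1]
    linarith [hx.1]
  have hL := Real.log_nonneg hx1
  have hq := Real.quadratic_le_exp_of_nonneg hL
  rw [Real.exp_log (by linarith)] at hq
  rw [div_lt_iff₀ (by linarith)] at h
  rw [le_div_iff₀ (by linarith)]
  set L := Real.log (x / (1 - x))
  have := mul_le_mul_of_nonneg_left h.le hL
  nlinarith

theorem image_odds_quotient (ha0 : 0 < a) (ha1 : a < 1) :
    (fun x => (x / (1 - x) - 1) / (hypRatio a x - 1)) '' Ioo (1 / 2) 1 =
      Ioi (Real.pi / Real.sin (Real.pi * a) * hypF a (1 / 2) ^ 2) :=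
  (strictMonoOn_odds_quotient ha0 ha1).image_Ioo_eq_Ioi (by norm_num)
    (continuousOn_quotient ha0 ha1 fun _ hx => hasDerivAt_div_one_sub_sub_one hx)
    (tendsto_odds_quotient_half ha0 ha1) (tendsto_odds_quotient_one ha0 ha1)

theorem image_hypRatio (ha0 : 0 < a) (ha1 : a < 1) :
    hypRatio a '' Ioo (1 / 2) 1 = Ioi 1 := by
  have hs : Ioo (1 / 2 : ℝ) 1 ⊆ Ioo 0 1 := Ioo_subset_Ico_self.trans Ico_half_subset
  refine ((strictMonoOn_hypRatio ha0 ha1).mono hs).image_Ioo_eq_Ioi (by norm_num)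
    (fun x hx => (hasDerivAt_hypRatio ha0 ha1 (hs hx)).continuousAt.continuousWithinAt) ?_ ?_
  · have := (hasDerivAt_hypRatio ha0 ha1 (x := 1 / 2) (by norm_num)).continuousAt.tendsto
    rw [hypRatio_half ha0 ha1] at this
    exact this.mono_left nhdsWithin_le_nhds
  · simpa using tendsto_atTop_add_const_right _ 1 (tendsto_hypRatio_atTop ha0 ha1)

theorem stmt14 (a : ℝ) (ha : a ∈ Set.Ioc (0 : ℝ) (1 / 2)) (t : ℝ)
    (ht : t = 4 * ellK a (1 / Real.sqrt 2) ^ 2 / (Real.pi * Real.sin (Real.pi * a))) :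
    (StrictAntiOn (fun K : ℝ => Real.log (lambdaA a K) / (K - 1)) (Set.Ioi 1) ∧
      (fun K : ℝ => Real.log (lambdaA a K) / (K - 1)) '' Set.Ioi 1 =
        Set.Ioo (Real.pi / Real.sin (Real.pi * a)) t) ∧
    (StrictMonoOn (fun K : ℝ => (lambdaA a K - 1) / (K - 1)) (Set.Ioi 1) ∧
      (fun K : ℝ => (lambdaA a K - 1) / (K - 1)) '' Set.Ioi 1 = Set.Ioi t) ∧
    ∀ K : ℝ, 1 < K →
      max (Real.exp (Real.pi * (K - 1) / Real.sin (Real.pi * a))) (1 + t * (K - 1)) <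
          lambdaA a K ∧
        lambdaA a K < Real.exp (t * (K - 1)) := by
  have ha0 : 0 < a := ha.1
  have ha1 : a < 1 := by linarith [ha.2]
  have hs : Ioo (1 / 2 : ℝ) 1 ⊆ Ioo 0 1 := Ioo_subset_Ico_self.trans Ico_half_subset
  have ht' : Real.pi / Real.sin (Real.pi * a) * hypF a (1 / 2) ^ 2 = t := by
    rw [ht, ellK_eq, one_div_sqrt_two_sq]
    field_simp
    ring
  have hiff : ∀ x ∈ Ioo (1 / 2 : ℝ) 1, ∀ y ∈ Ioo (1 / 2 : ℝ) 1,
      hypRatio a x < hypRatio a y → x < y := fun x hx y hy =>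
    ((strictMonoOn_hypRatio ha0 ha1).lt_iff_lt (hs hx) (hs hy)).1
  have himg₁ : (fun K : ℝ => Real.log (lambdaA a K) / (K - 1)) '' Ioi 1 =
      Ioo (Real.pi / Real.sin (Real.pi * a)) t := by
    have h := congrArg (fun s : Set ℝ => (fun y => -y) '' s) (image_neg_log_quotient ha0 ha1)
    simp only [image_neg_eq_neg, neg_Ioo, neg_neg, ht'] at h
    rw [← h, ← image_neg_eq_neg, image_image, ← image_hypRatio ha0 ha1, image_image]
    refine image_congr fun x hx => ?_
    rw [lambdaA_hypRatio ha0 ha1 (hs hx), neg_div, neg_neg]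
  have himg₂ : (fun K : ℝ => (lambdaA a K - 1) / (K - 1)) '' Ioi 1 = Ioi t := by
    rw [← ht', ← image_odds_quotient ha0 ha1, ← image_hypRatio ha0 ha1, image_image]
    exact image_congr fun x hx => by rw [lambdaA_hypRatio ha0 ha1 (hs hx)]
  refine ⟨⟨?_, himg₁⟩, ⟨?_, himg₂⟩, fun K hK => ?_⟩
  · rw [← image_hypRatio ha0 ha1]
    rintro _ ⟨x, hx, rfl⟩ _ ⟨y, hy, rfl⟩ hxy
    have h := strictMonoOn_neg_log_quotient ha0 ha1 hx hy (hiff x hx y hy hxy)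
    simp only [neg_div, neg_lt_neg_iff] at h
    simpa only [lambdaA_hypRatio ha0 ha1 (hs hx), lambdaA_hypRatio ha0 ha1 (hs hy)] using h
  · rw [← image_hypRatio ha0 ha1]
    rintro _ ⟨x, hx, rfl⟩ _ ⟨y, hy, rfl⟩ hxy
    have h := strictMonoOn_odds_quotient ha0 ha1 hx hy (hiff x hx y hy hxy)
    simpa only [lambdaA_hypRatio ha0 ha1 (hs hx), lambdaA_hypRatio ha0 ha1 (hs hy)] using h
  · have hK0 : 0 < K - 1 := sub_pos.2 hK
    have h₁ : Real.log (lambdaA a K) / (K - 1) ∈ Ioo (Real.pi / Real.sin (Real.pi * a)) t :=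
      himg₁ ▸ mem_image_of_mem (fun K : ℝ => Real.log (lambdaA a K) / (K - 1)) hK
    have h₂ : (lambdaA a K - 1) / (K - 1) ∈ Ioi t :=
      himg₂ ▸ mem_image_of_mem (fun K : ℝ => (lambdaA a K - 1) / (K - 1)) hK
    have hpos : 0 < lambdaA a K := by
      obtain ⟨x, hx, rfl⟩ := (image_hypRatio ha0 ha1).symm ▸ (show K ∈ Ioi 1 from hK)
      rw [lambdaA_hypRatio ha0 ha1 (hs hx)]
      exact div_pos (hs hx).1 (by linarith [hx.2])
    rw [mem_Ioo, lt_div_iff₀ hK0, div_lt_iff₀ hK0] at h₁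
    rw [mem_Ioi, lt_div_iff₀ hK0] at h₂
    refine ⟨max_lt ?_ (by linarith), ?_⟩
    · rw [← Real.lt_log_iff_exp_lt hpos, mul_div_right_comm]
      exact h₁.1
    · rw [← Real.log_lt_iff_lt_exp hpos]
      exact h₁.2
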